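/- Let d ≥ 2, let w : Fin d → ℝ be nonzero, let c ∈ ℝ, and let x : Fin d → ℝ. Let ρ₁, ρ_∞ > 0 with ρ_∞ < ρ₁ < d·ρ_∞, let p ∈ (1, ∞) with Hölder conjugate q (1/p + 1/q = 1), and set α = ρ₁/ρ_∞ − ⌊ρ₁/ρ_∞⌋. Let H = {z : Fin d → ℝ | ∑ i, w i * z i = c} be the hyperplane defined by (w, c). If every z ∈ H satisfies ‖z − x‖₁ ≥ ρ₁ and every z ∈ H satisfies ‖z − x‖_∞ ≥ ρ_∞, then every z ∈ H satisfies ‖z − x‖_p ≥ ρ₁ / (ρ₁/ρ_∞ − α + α^q)^(1/q). -/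

import Mathlib

open Finset

noncomputable def lpnorm {d : ℕ} (p : ℝ) (x : Fin d → ℝ) : ℝ :=
  (∑ i, |x i| ^ p) ^ (1 / p)

noncomputable def l1norm {d : ℕ} (x : Fin d → ℝ) : ℝ := ∑ i, |x i|

noncomputable def linfnorm {d : ℕ} (x : Fin d → ℝ) : ℝ := ⨆ i, |x i|

noncomputable def auxF (q s : ℝ) : ℝ := (⌊s⌋ : ℝ) + (Int.fract s) ^ q

theorem auxF_mono (q : ℝ) (hq : 1 < q) {s t : ℝ} (h : s ≤ t) : auxF q s ≤ auxF q t := by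
  unfold auxF
  have hs0 := Int.fract_nonneg s
  have ht0 := Int.fract_nonneg t
  have hs1 := Int.fract_lt_one s
  rcases (Int.floor_mono h).eq_or_lt with he | hl
  · rw [he]
    have : Int.fract s ≤ Int.fract t := by
      rw [← Int.self_sub_floor, ← Int.self_sub_floor, he]; linarith
    have := Real.rpow_le_rpow hs0 this (by linarith : (0:ℝ) ≤ q)
    linarith
  · have h1 : (Int.fract s) ^ q ≤ 1 := Real.rpow_le_one hs0 hs1.le (by linarith)
    have h2 : 0 ≤ (Int.fract t) ^ q := Real.rpow_nonneg ht0 q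
    have h3 : (⌊s⌋ : ℝ) + 1 ≤ ⌊t⌋ := by exact_mod_cast hl
    linarith

theorem aux_convex (q : ℝ) (hq : 1 < q) {a u : ℝ} (ha1 : a < 1) (hu1 : u ≤ 1)
    (h : 1 ≤ a + u) : a ^ q + u ^ q ≤ 1 + (a + u - 1) ^ q := by
  have hc := (convexOn_rpow hq.le).2
  have hb : 0 < 1 - (a + u - 1) := by linarith
  have hb0 : (a + u - 1) ∈ Set.Ici (0:ℝ) := by simp only [Set.mem_Ici]; linarith
  have h10 : (1:ℝ) ∈ Set.Ici (0:ℝ) := by simp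
  obtain ⟨l, hl⟩ : ∃ l, l = (1 - u) / (1 - (a + u - 1)) := ⟨_, rfl⟩
  have hl0 : 0 ≤ l := by rw [hl]; apply div_nonneg <;> linarith
  have hl1 : l ≤ 1 := by rw [hl, div_le_one hb]; linarith
  have hlm : l * (1 - (a + u - 1)) = 1 - u := by rw [hl]; field_simp
  have e1 := hc hb0 h10 (by linarith : 0 ≤ 1 - l) hl0 (by ring)
  have e2 := hc hb0 h10 hl0 (by linarith : 0 ≤ 1 - l) (by ring)
  simp only [smul_eq_mul, Real.one_rpow] at e1 e2
  have f1 : (1 - l) * (a + u - 1) + l * 1 = a := by linarith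
  have f2 : l * (a + u - 1) + (1 - l) * 1 = u := by linarith
  rw [f1] at e1
  rw [f2] at e2
  linarith

theorem auxF_add (q : ℝ) (hq : 1 < q) (s u : ℝ) (hu0 : 0 ≤ u) (hu1 : u ≤ 1) :
    auxF q s + u ^ q ≤ auxF q (s + u) := by
  have hs0 := Int.fract_nonneg s
  have hs1 := Int.fract_lt_one s
  have hsf := Int.self_sub_floor s
  unfold auxF
  by_cases h : Int.fract s + u < 1
  · have hf : ⌊s + u⌋ = ⌊s⌋ := by
      rw [Int.floor_eq_iff]; constructor <;> linarith
    have : Int.fract (s + u) = Int.fract s + u := by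
      rw [← Int.self_sub_floor (s + u), hf]; linarith
    rw [this, hf]
    have := Real.add_rpow_le_rpow_add hs0 hu0 hq.le
    linarith
  · have hf : ⌊s + u⌋ = ⌊s⌋ + 1 := by
      rw [Int.floor_eq_iff]; push_cast; constructor <;> linarith
    have : Int.fract (s + u) = Int.fract s + u - 1 := by
      rw [← Int.self_sub_floor (s + u), hf]; push_cast; linarith
    rw [this, hf]
    have := aux_convex q hq hs1 hu1 (by linarith)
    push_cast
    linarith

theorem auxF_sum (q : ℝ) (hq : 1 < q) {ι : Type*} (S : Finset ι) (u : ι → ℝ)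
    (h0 : ∀ i, 0 ≤ u i) (h1 : ∀ i, u i ≤ 1) :
    ∑ i ∈ S, u i ^ q ≤ auxF q (∑ i ∈ S, u i) := by
  classical
  induction S using Finset.induction_on with
  | empty => simp [auxF, Real.zero_rpow (by linarith : q ≠ 0)]
  | insert a S ha ih =>
    rw [Finset.sum_insert ha, Finset.sum_insert ha]
    have := auxF_add q hq (∑ i ∈ S, u i) (u a) (h0 a) (h1 a)
    rw [add_comm (u a)]
    linarith

theorem hyperplane_lp_distance_bound
    (d : ℕ) (hd : 2 ≤ d) (w : Fin d → ℝ) (hw : w ≠ 0) (c : ℝ)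
    (x : Fin d → ℝ)
    (ρ1 ρinf : ℝ) (hρ1 : 0 < ρ1) (hρinf : 0 < ρinf)
    (h1 : ρinf < ρ1) (h2 : ρ1 < d * ρinf)
    (p q : ℝ) (hp : 1 < p) (hpq : 1 / p + 1 / q = 1)
    (α : ℝ) (hα : α = ρ1 / ρinf - ⌊ρ1 / ρinf⌋)
    (hH1 : ∀ z : Fin d → ℝ, (∑ i, w i * z i) = c → l1norm (z - x) ≥ ρ1)
    (hHinf : ∀ z : Fin d → ℝ, (∑ i, w i * z i) = c → linfnorm (z - x) ≥ ρinf) :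
    ∀ z : Fin d → ℝ, (∑ i, w i * z i) = c →
      lpnorm p (z - x) ≥ ρ1 / (ρ1 / ρinf - α + α ^ q) ^ (1 / q) := by
  intro z hz
  have hp0 : 0 < p := by linarith
  have hq1 : 1 < q := by
    have hp1 : 1 / p < 1 := by rw [div_lt_one hp0]; exact hp
    have hp2 : 0 < 1 / p := by positivity
    have hqp : 0 < 1 / q := by linarith
    have hq0 : 0 < q := by simpa using hqp
    have : 1 / q < 1 := by linarith
    rwa [div_lt_one hq0] at this
  have hconj : q.HolderConjugate p := by
    rw [Real.holderConjugate_iff]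
    refine ⟨hq1, ?_⟩
    simp only [one_div] at hpq
    linarith
  obtain ⟨δ, hδ⟩ : ∃ δ, δ = c - ∑ i, w i * x i := ⟨_, rfl⟩
  -- each coordinate
  have hcoord : ∀ j, ρ1 * |w j| ≤ |δ| := by
    intro j
    by_cases hj : w j = 0
    · simp [hj]
    have := hH1 (x + Pi.single j (δ / w j)) (by
      simp only [Pi.add_apply, mul_add, Finset.sum_add_distrib, Pi.single_apply, mul_ite, mul_zero,
        Finset.sum_ite_eq', Finset.sum_ite_eq, Finset.mem_univ, if_true]
      rw [mul_div_cancel₀ _ hj, hδ]; ring)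
    have e : l1norm (x + Pi.single j (δ / w j) - x) = |δ| / |w j| := by
      rw [add_sub_cancel_left, l1norm, Finset.sum_eq_single j]
      · simp [abs_div]
      · intro b _ hb; simp [hb]
      · simp
    rw [e, ge_iff_le, le_div_iff₀ (abs_pos.mpr hj)] at this
    exact this
  obtain ⟨j0, hj0⟩ : ∃ j, w j ≠ 0 := Function.ne_iff.mp hw
  have hδpos : 0 < |δ| := lt_of_lt_of_le (mul_pos hρ1 (abs_pos.mpr hj0)) (hcoord j0)
  have hWpos : 0 < ∑ i, |w i| :=
    Finset.sum_pos' (fun i _ => abs_nonneg _) ⟨j0, Finset.mem_univ _, abs_pos.mpr hj0⟩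
  have hsum : ρinf * ∑ i, |w i| ≤ |δ| := by
    have hne : Nonempty (Fin d) := ⟨j0⟩
    have := hHinf (x + fun i => δ / (∑ i, |w i|) * SignType.sign (w i)) (by
      have : ∀ i, w i * (δ / (∑ i, |w i|) * (SignType.sign (w i) : ℝ))
          = δ / (∑ i, |w i|) * |w i| := by
        intro i
        rw [← self_mul_sign (w i)]; ring
      simp only [Pi.add_apply, mul_add, Finset.sum_add_distrib, this]
      rw [← Finset.mul_sum, div_mul_cancel₀ _ hWpos.ne', hδ]; ring)
    rw [add_sub_cancel_left] at this
    have e : linfnorm (fun i => δ / (∑ i, |w i|) * (SignType.sign (w i) : ℝ))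
        ≤ |δ| / ∑ i, |w i| := by
      apply ciSup_le
      intro i
      rw [abs_mul, abs_div, abs_of_pos hWpos]
      apply mul_le_of_le_one_right (by positivity)
      rcases SignType.sign (w i) with _ | _ | _ <;> simp
    have := this.le.trans e
    rwa [le_div_iff₀ hWpos] at this
  have hd0 : ∑ i, w i * (z - x) i = δ := by
    simp only [Pi.sub_apply, mul_sub, Finset.sum_sub_distrib, hz, hδ]
  have hK : ρ1 / ρinf - α + α ^ q = auxF q (ρ1 / ρinf) := by
    rw [hα]; unfold auxF; rw [Int.self_sub_floor]
    linarith [Int.self_sub_floor (ρ1 / ρinf)]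
  rw [hK]
  have hKpos : 0 < auxF q (ρ1 / ρinf) := by
    have hf : (1:ℤ) ≤ ⌊ρ1 / ρinf⌋ := by
      rw [Int.le_floor]; push_cast; rw [le_div_iff₀ hρinf]; linarith
    have hf' : (1:ℝ) ≤ ⌊ρ1 / ρinf⌋ := by exact_mod_cast hf
    have := Real.rpow_nonneg (Int.fract_nonneg (ρ1 / ρinf)) q
    unfold auxF; linarith
  obtain ⟨u, hu⟩ : ∃ u : Fin d → ℝ, u = fun i => ρ1 / |δ| * w i := ⟨_, rfl⟩
  have hua : ∀ i, |u i| = ρ1 / |δ| * |w i| := by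
    intro i; rw [hu]; simp only; rw [abs_mul, abs_div, abs_abs, abs_of_pos hρ1]
  have hu1 : ∀ i, |u i| ≤ 1 := by
    intro i
    rw [hua, div_mul_eq_mul_div, div_le_one hδpos]; exact hcoord i
  have hus : ∑ i, |u i| ≤ ρ1 / ρinf := by
    simp only [hua]
    rw [← Finset.mul_sum, div_mul_eq_mul_div, div_le_div_iff₀ hδpos hρinf]
    nlinarith
  have hq_sum : ∑ i, |u i| ^ q ≤ auxF q (ρ1 / ρinf) :=
    (auxF_sum q hq1 Finset.univ (fun i => |u i|) (fun i => abs_nonneg _) hu1).trans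
      (auxF_mono q hq1 hus)
  have hpair : |∑ i, u i * (z - x) i| = ρ1 := by
    have : ∑ i, u i * (z - x) i = ρ1 / |δ| * δ := by
      rw [← hd0, Finset.mul_sum, hd0, hu]
      exact Finset.sum_congr rfl fun i _ => by ring
    rw [this, abs_mul, abs_div, abs_abs, abs_of_pos hρ1, div_mul_cancel₀ _ hδpos.ne']
  have hold := Real.inner_le_Lp_mul_Lq Finset.univ (fun i => |u i|) (fun i => |(z - x) i|) hconj
  simp only [abs_abs] at hold
  have hfin : ρ1 ≤ (∑ i, |u i| ^ q) ^ (1 / q) * lpnorm p (z - x) := by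
    refine le_trans ?_ hold
    rw [← hpair]
    refine (Finset.abs_sum_le_sum_abs _ _).trans (le_of_eq ?_)
    exact Finset.sum_congr rfl fun i _ => abs_mul _ _
  have hlp : 0 ≤ lpnorm p (z - x) :=
    Real.rpow_nonneg (Finset.sum_nonneg fun i _ => Real.rpow_nonneg (abs_nonneg _) _) _
  have hmono : (∑ i, |u i| ^ q) ^ (1 / q) ≤ (auxF q (ρ1 / ρinf)) ^ (1 / q) :=
    Real.rpow_le_rpow (Finset.sum_nonneg fun i _ => Real.rpow_nonneg (abs_nonneg _) _) hq_sum
      (by positivity)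
  rw [ge_iff_le, div_le_iff₀ (Real.rpow_pos_of_pos hKpos _), mul_comm]
  exact hfin.trans (mul_le_mul_of_nonneg_right hmono hlp)
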